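/- Let d ≥ 1 and n = d+1. For any code that satisfies node regeneration, for any fixed s ∈ [1:n] and any 0 ≤ t₁ ≤ t₂ ≤ s−1, U^{(t₂,s)} is a deterministic function of U^{(t₁,s)}, and hence H(U^{(t₂,s)}) ≤ H(U^{(t₁,s)}). -/

import Mathlib

open scoped BigOperators Classical

namespace MDCSR

noncomputable section

/-- `X` is a deterministic function of `Y`. -/
def IsFuncOf {Ω α β : Type*} (X : Ω → α) (Y : Ω → β) : Prop :=
  ∃ f : β → α, ∀ ω, X ω = f (Y ω)

variable {Ω V : Type} [Fintype Ω]

/-- Probability of the event `X = x` under the probability mass function `p`. -/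
def pm (p : Ω → ℝ) {α : Type*} (X : Ω → α) (x : α) : ℝ :=
  ∑ ω ∈ Finset.univ.filter (fun ω' => X ω' = x), p ω

/-- Shannon entropy of the random variable `X` under the probability mass function `p`. -/
def H (p : Ω → ℝ) {α : Type*} (X : Ω → α) : ℝ :=
  -∑ ω, p ω * Real.log (pm p X (X ω))

/-- An `(n = d+1, d)` code: messages `M 1, …, M d`, a key `K`, node contents
`W 1, …, W (d+1)`, and repair data `S i j` (data downloaded from node `i` to repair
node `j`), all random variables on a common finite probability space `(Ω, p)`.
The messages are mutually independent, the key is independent of the messages,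
each `W i` is a deterministic function of the messages and the key, and each
`S i j` is a deterministic function of `W i`. -/
structure Code (Ω V : Type) [Fintype Ω] (d : ℕ) : Type where
  p : Ω → ℝ
  p_nonneg : ∀ ω, 0 ≤ p ω
  p_sum : ∑ ω, p ω = 1
  M : ℕ → Ω → V
  K : Ω → V
  W : ℕ → Ω → V
  S : ℕ → ℕ → Ω → V
  M_indep : ∀ x : ℕ → V,
    pm p (fun ω (i : Fin d) => M (↑i + 1) ω) (fun i => x (↑i + 1)) =
      ∏ i ∈ Finset.Icc 1 d, pm p (M i) (x i)
  K_indep : ∀ (k : V) (x : ℕ → V),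
    pm p (fun ω => (K ω, fun (i : Fin d) => M (↑i + 1) ω)) (k, fun i => x (↑i + 1)) =
      pm p K k * pm p (fun ω (i : Fin d) => M (↑i + 1) ω) (fun i => x (↑i + 1))
  W_func : ∀ i ∈ Finset.Icc 1 (d + 1),
    IsFuncOf (W i) (fun ω => ((fun (j : Fin d) => M (↑j + 1) ω), K ω))
  S_func : ∀ i ∈ Finset.Icc 1 (d + 1), ∀ j ∈ Finset.Icc 1 (d + 1), i ≠ j →
    IsFuncOf (S i j) (W i)

/-- Descriptors for the basic random variables of a code. -/
inductive Atom where
  | M : ℕ → Atom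
  | K : Atom
  | W : ℕ → Atom
  | S : ℕ → ℕ → Atom

variable {d : ℕ}

/-- The random variable described by an atom. -/
def Code.atomRV (C : Code Ω V d) : Atom → Ω → V
  | .M i => C.M i
  | .K => C.K
  | .W i => C.W i
  | .S i j => C.S i j

/-- The joint random variable (tuple) described by a list of atoms. -/
def Code.rv (C : Code Ω V d) (L : List Atom) : Ω → List V :=
  fun ω => L.map fun a => C.atomRV a ω

/-- Joint entropy of a tuple of basic random variables. -/
def Code.HL (C : Code Ω V d) (L : List Atom) : ℝ := H C.p (C.rv L)

/-- Conditional entropy `H(L₁ | L₂)`. -/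
def Code.CH (C : Code Ω V d) (L₁ L₂ : List Atom) : ℝ := C.HL (L₁ ++ L₂) - C.HL L₂

/-- Mutual information `I(L₁ ; L₂)`. -/
def Code.MI (C : Code Ω V d) (L₁ L₂ : List Atom) : ℝ :=
  C.HL L₁ + C.HL L₂ - C.HL (L₁ ++ L₂)

/-- Relabeling of an atom along a permutation of the storage-node indices. -/
def Atom.perm (π : Equiv.Perm ℕ) : Atom → Atom
  | .M i => .M i
  | .K => .K
  | .W i => .W (π i)
  | .S i j => .S (π i) (π j)

/-- A code is symmetrical if every joint entropy of a tuple of the basic random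
variables is invariant under every permutation of the storage-node indices `[1:n]`. -/
def Code.Symmetrical (C : Code Ω V d) : Prop :=
  ∀ π : Equiv.Perm ℕ, (∀ i ∈ Finset.Icc 1 (d + 1), π i ∈ Finset.Icc 1 (d + 1)) →
    ∀ L : List Atom, C.HL (L.map (Atom.perm π)) = C.HL L

/-- The list `[a, a+1, …, b]`. -/
def icc (a b : ℕ) : List ℕ := List.range' a (b + 1 - a)

/-- `W_A` as a list of atoms. -/
def Ws (A : List ℕ) : List Atom := A.map Atom.W

/-- `M_A` as a list of atoms. -/
def MsL (A : List ℕ) : List Atom := A.map Atom.M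

/-- `M^{(m)} = (M_1, …, M_m)`. -/
def Mup (m : ℕ) : List Atom := MsL (icc 1 m)

/-- `S_{B → j}`. -/
def Sto (B : List ℕ) (j : ℕ) : List Atom := B.map fun i => Atom.S i j

/-- `S_{i → B}`. -/
def Sfrom (i : ℕ) (B : List ℕ) : List Atom := B.map fun j => Atom.S i j

/-- `S̄_{→ j} = S_{[j+1:n] → j}` (here `n = d+1`). -/
def SbarTo (d j : ℕ) : List Atom := Sto (icc (j + 1) (d + 1)) j

/-- `S̄_{→ A}`. -/
def SbarToL (d : ℕ) (A : List ℕ) : List Atom := (A.map (SbarTo d)).flatten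

/-- `S̲_{→ j} = S_{[1:j-1] → j}`. -/
def SunderTo (j : ℕ) : List Atom := Sto (icc 1 (j - 1)) j

/-- `S̲_{→ A}`. -/
def SunderToL (A : List ℕ) : List Atom := (A.map SunderTo).flatten

/-- `S_{→ j} = S_{([1:n] ∖ {j}) → j}` (here `n = d+1`). -/
def StoFull (d j : ℕ) : List Atom := Sto ((icc 1 (d + 1)).filter (fun i => i ≠ j)) j

/-- `(S_{→ j} : j ∈ A)`. -/
def StoFullL (d : ℕ) (A : List ℕ) : List Atom := (A.map (StoFull d)).flatten

/-- `U^{(t,s)} = (W_{[1:t]}, S̄_{→[t+1:s]})`. -/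
def U (d t s : ℕ) : List Atom := Ws (icc 1 t) ++ SbarToL d (icc (t + 1) s)

/-- Node regeneration: each `W j` is a deterministic function of `S_{→ j}`. -/
def Code.NodeRegen (C : Code Ω V d) : Prop :=
  ∀ j ∈ Finset.Icc 1 (d + 1), IsFuncOf (C.W j) (C.rv (StoFull d j))

/-- Message recovery for parameter `ℓ`: `M j` is constant for `j ∈ [1:ℓ]`, and for every
`A ⊆ [1:n]` with `|A| ∈ [ℓ+1:d]`, `M_{|A|}` is a deterministic function of `W_A`. -/
def Code.MsgRecovery (C : Code Ω V d) (ℓ : ℕ) : Prop :=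
  (∀ j ∈ Finset.Icc 1 ℓ, ∃ c : V, ∀ ω, C.M j ω = c) ∧
  ∀ A : Finset ℕ, A ⊆ Finset.Icc 1 (d + 1) → A.card ∈ Finset.Icc (ℓ + 1) d →
    IsFuncOf (C.M A.card) (C.rv (Ws (A.sort (· ≤ ·))))

/-- Repair secrecy for parameters `ℓ₁, ℓ₂`: for all disjoint `E₁, E₂ ⊆ [1:n]` with
`|E₁| = ℓ₁`, `|E₂| = ℓ₂`, the messages `M_{ℓ+1}, …, M_d` are independent of
`((W_i : i ∈ E₁), (S_{→j} : j ∈ E₂))`, where `ℓ = ℓ₁ + ℓ₂`. -/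
def Code.RepairSecrecy (C : Code Ω V d) (ℓ₁ ℓ₂ : ℕ) : Prop :=
  ∀ E₁ E₂ : Finset ℕ, E₁ ⊆ Finset.Icc 1 (d + 1) → E₂ ⊆ Finset.Icc 1 (d + 1) →
    Disjoint E₁ E₂ → E₁.card = ℓ₁ → E₂.card = ℓ₂ →
    C.MI (MsL (icc (ℓ₁ + ℓ₂ + 1) d))
      (Ws (E₁.sort (· ≤ ·)) ++ StoFullL d (E₂.sort (· ≤ ·))) = 0

/-- `T_{d,k,ℓ} = Σ_{t=ℓ+1}^{k} (d+1−t)`, as a real number. -/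
def T (d k ℓ : ℕ) : ℝ := ∑ t ∈ Finset.Icc (ℓ + 1) k, ((d : ℝ) + 1 - (t : ℝ))


theorem IsFuncOf.of_eq_imp {Ω α β : Type*} [Nonempty α] {X : Ω → α} {Y : Ω → β}
    (h : ∀ ω ω', Y ω = Y ω' → X ω = X ω') : IsFuncOf X Y := by
  have hf : Function.FactorsThrough X Y := fun ω ω' => h ω ω'
  exact ⟨Function.extend Y X fun _ => Classical.arbitrary α, fun ω => (hf.extend_apply _ ω).symm⟩

theorem IsFuncOf.eq_of_eq {Ω α β : Type*} {X : Ω → α} {Y : Ω → β} (h : IsFuncOf X Y)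
    {ω ω' : Ω} (hY : Y ω = Y ω') : X ω = X ω' := by
  obtain ⟨f, hf⟩ := h
  rw [hf, hf, hY]

/-- A deterministic function of `Y` has at most the entropy of `Y`. -/
theorem H_le_of_isFuncOf {p : Ω → ℝ} (hp : ∀ ω, 0 ≤ p ω) {α β : Type*} {X : Ω → α} {Y : Ω → β}
    (h : IsFuncOf X Y) : H p X ≤ H p Y := by
  refine neg_le_neg (Finset.sum_le_sum fun ω _ => ?_)
  rcases (hp ω).eq_or_lt with h0 | hpos
  · simp [← h0]
  have hY : p ω ≤ pm p Y (Y ω) :=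
    Finset.single_le_sum (fun ω' _ => hp ω') (by simp)
  have hYX : pm p Y (Y ω) ≤ pm p X (X ω) := by
    refine Finset.sum_le_sum_of_subset_of_nonneg (fun ω' hω' => ?_) fun ω' _ _ => hp ω'
    simp only [Finset.mem_filter, Finset.mem_univ, true_and] at hω' ⊢
    exact h.eq_of_eq hω'
  exact mul_le_mul_of_nonneg_left (Real.log_le_log (hpos.trans_le hY) hYX) (hp ω)

theorem Code.rv_eq_iff (C : Code Ω V d) {L : List Atom} {ω ω' : Ω} :
    C.rv L ω = C.rv L ω' ↔ ∀ a ∈ L, C.atomRV a ω = C.atomRV a ω' :=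
  List.map_inj_left

theorem mem_icc {a b i : ℕ} : i ∈ icc a b ↔ a ≤ i ∧ i ≤ b := by
  simp only [icc, List.mem_range'_1]
  omega

theorem mem_U {d t s : ℕ} {a : Atom} :
    a ∈ U d t s ↔ (∃ i, (1 ≤ i ∧ i ≤ t) ∧ Atom.W i = a) ∨
      ∃ j, (t + 1 ≤ j ∧ j ≤ s) ∧ ∃ i, (j + 1 ≤ i ∧ i ≤ d + 1) ∧ Atom.S i j = a := by
  simp [U, Ws, SbarToL, SbarTo, Sto, mem_icc]

theorem mem_StoFull {d j : ℕ} {a : Atom} :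
    a ∈ StoFull d j ↔ ∃ i, ((1 ≤ i ∧ i ≤ d + 1) ∧ i ≠ j) ∧ Atom.S i j = a := by
  simp [StoFull, Sto, mem_icc]

/-- Node `j` is regenerated from the nodes below it and the repair data sent from above it. -/
theorem Code.W_eq_of_rv_U_eq (C : Code Ω V d) (hregen : C.NodeRegen) {s t : ℕ}
    (hs : s ≤ d + 1) {ω ω' : Ω} (h : C.rv (U d t s) ω = C.rv (U d t s) ω') (j : ℕ)
    (hj : 1 ≤ j) (hjs : j ≤ s) : C.W j ω = C.W j ω' := by
  rw [C.rv_eq_iff] at h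
  induction j using Nat.strong_induction_on with
  | _ j ih =>
    rcases le_or_gt j t with hjt | hjt
    · exact h (.W j) (mem_U.2 (.inl ⟨j, ⟨hj, hjt⟩, rfl⟩))
    refine (hregen j (Finset.mem_Icc.2 ⟨hj, hjs.trans hs⟩)).eq_of_eq (C.rv_eq_iff.2 fun a ha => ?_)
    obtain ⟨i, ⟨⟨hi, hid⟩, hij⟩, rfl⟩ := mem_StoFull.1 ha
    rcases hij.lt_or_gt with hlt | hgt
    · exact (C.S_func i (Finset.mem_Icc.2 ⟨hi, hid⟩) j
        (Finset.mem_Icc.2 ⟨hj, hjs.trans hs⟩) hij).eq_of_eq (ih i hlt hi (hlt.le.trans hjs))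
    · exact h (.S i j) (mem_U.2 (.inr ⟨j, ⟨hjt, hjs⟩, i, ⟨hgt, hid⟩, rfl⟩))

theorem statement5 {Ω V : Type} [Fintype Ω] {d : ℕ} (hd : 1 ≤ d)
    (C : Code Ω V d) (hregen : C.NodeRegen)
    {s t₁ t₂ : ℕ} (hs : s ∈ Finset.Icc 1 (d + 1)) (h₁₂ : t₁ ≤ t₂) (h₂ : t₂ ≤ s - 1) :
    IsFuncOf (C.rv (U d t₂ s)) (C.rv (U d t₁ s)) ∧ C.HL (U d t₂ s) ≤ C.HL (U d t₁ s) := by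
  obtain ⟨hs₁, hsd⟩ := Finset.mem_Icc.1 hs
  have hfunc : IsFuncOf (C.rv (U d t₂ s)) (C.rv (U d t₁ s)) := by
    refine IsFuncOf.of_eq_imp fun ω ω' h => C.rv_eq_iff.2 fun a ha => ?_
    rcases mem_U.1 ha with ⟨i, ⟨hi, hit⟩, rfl⟩ | ⟨j, ⟨hj, hjs⟩, i, hi, rfl⟩
    · exact C.W_eq_of_rv_U_eq hregen hsd h i hi (by omega)
    · exact C.rv_eq_iff.1 h _ (mem_U.2 (.inr ⟨j, ⟨by omega, hjs⟩, i, hi, rfl⟩))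
  exact ⟨hfunc, H_le_of_isFuncOf C.p_nonneg hfunc⟩

end

end MDCSR
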